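/- Let N ≥ 1 and let Y be a random vector in ℝ^N with rotationally invariant density f(y) = g(‖y‖). Assume the relevant integrals exist and are finite. Then the differential entropy of Y satisfies h(Y) = h(‖Y‖^N) + log₂( π^{N/2} / Γ(N/2 + 1) ), where h(‖Y‖^N) = −∫_0^∞ f_T(t) log₂ f_T(t) dt and f_T is the density of T = ‖Y‖^N. -/

import Mathlib

open MeasureTheory ProbabilityTheory Real Set

/-- Under `x ↦ ‖x‖ ^ dim E`, an additive Haar measure is pushed forward to a multiple of the
Lebesgue measure on `[0, ∞)`. -/
theorem map_norm_pow_finrank_addHaar {E : Type*} [NormedAddCommGroup E] [NormedSpace ℝ E]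
    [FiniteDimensional ℝ E] [Nontrivial E] [MeasurableSpace E] [BorelSpace E]
    (μ : Measure E) [μ.IsAddHaarMeasure] :
    μ.map (fun x => ‖x‖ ^ Module.finrank ℝ E) =
      μ (Metric.ball 0 1) • volume.restrict (Ici (0 : ℝ)) := by
  have hn : Module.finrank ℝ E ≠ 0 := Module.finrank_pos.ne'
  have hmeas : Measurable fun x : E => ‖x‖ ^ Module.finrank ℝ E := by fun_prop
  have hmap (t : ℝ) : μ.map (fun x => ‖x‖ ^ Module.finrank ℝ E) (Iic t) =
      ENNReal.ofReal t * μ (Metric.ball 0 1) := by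
    rw [Measure.map_apply hmeas measurableSet_Iic]
    rcases lt_or_ge t 0 with ht | ht
    · have : (fun x : E => ‖x‖ ^ Module.finrank ℝ E) ⁻¹' Iic t = ∅ := by
        ext x
        simpa using ht.trans_le (by positivity)
      rw [this, ENNReal.ofReal_of_nonpos ht.le]
      simp
    · have hr : 0 ≤ t ^ ((Module.finrank ℝ E : ℝ)⁻¹) := by positivity
      have : (fun x : E => ‖x‖ ^ Module.finrank ℝ E) ⁻¹' Iic t =
          Metric.closedBall 0 (t ^ ((Module.finrank ℝ E : ℝ)⁻¹)) := by
        ext x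
        rw [mem_preimage, mem_Iic, mem_closedBall_zero_iff, ← pow_le_pow_iff_left₀ (norm_nonneg x)
          hr hn, Real.rpow_inv_natCast_pow ht hn]
      rw [this, Measure.addHaar_closedBall μ 0 hr, Real.rpow_inv_natCast_pow ht hn]
  have hvol (t : ℝ) : (μ (Metric.ball 0 1) • volume.restrict (Ici (0 : ℝ))) (Iic t) =
      ENNReal.ofReal t * μ (Metric.ball 0 1) := by
    rw [Measure.smul_apply, Measure.restrict_apply measurableSet_Iic, Iic_inter_Ici,
      Real.volume_Icc, sub_zero, smul_eq_mul, mul_comm]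
  have hfin (t : ℝ) : ENNReal.ofReal t * μ (Metric.ball 0 1) ≠ ⊤ :=
    ENNReal.mul_ne_top ENNReal.ofReal_ne_top measure_ball_lt_top.ne
  refine Measure.ext_of_Ioc' _ _ (fun a b _ => ?_) fun a b hab => ?_
  · exact ((measure_mono Ioc_subset_Iic_self).trans_lt ((hmap b).trans_lt (hfin b).lt_top)).ne
  · rw [← Iic_sdiff_Iic,
      measure_sdiff (Iic_subset_Iic.2 hab.le) measurableSet_Iic.nullMeasurableSet
        (hmap a ▸ hfin a),
      measure_sdiff (Iic_subset_Iic.2 hab.le) measurableSet_Iic.nullMeasurableSet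
        (hvol a ▸ hfin a), hmap, hmap, hvol, hvol]

/-- Pushing forward a density that factors through the map. -/
theorem map_withDensity_comp {α β : Type*} [MeasurableSpace α] [MeasurableSpace β] (μ : Measure α)
    {q : α → β} (hq : Measurable q) {G : β → ENNReal} (hG : Measurable G) :
    (μ.withDensity (G ∘ q)).map q = (μ.map q).withDensity G := by
  ext s hs
  rw [Measure.map_apply hq hs, withDensity_apply _ (hq hs), withDensity_apply _ hs,
    setLIntegral_map hs hG hq]
  rfl

/-- Effect on the (negative) entropy integral of multiplying a function by a constant. -/
theorem integral_const_mul_mul_logb {α : Type*} [MeasurableSpace α] {μ : Measure α} {c b : ℝ}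
    (hc : c ≠ 0) {G : α → ℝ} (hG : Integrable G μ)
    (hGl : Integrable (fun t => G t * Real.logb b (G t)) μ) :
    ∫ t, c * G t * Real.logb b (c * G t) ∂μ =
      c * ∫ t, G t * Real.logb b (G t) ∂μ + Real.logb b c * ∫ t, c * G t ∂μ := by
  rw [← integral_const_mul, ← integral_const_mul, ← integral_add (hGl.const_mul c)
    ((hG.const_mul c).const_mul _)]
  refine integral_congr_ae (.of_forall fun t => ?_)
  by_cases h : G t = 0
  · simp [h]
  · simp only [Real.logb_mul hc h]
    ring

/-- If `Y` is a random vector in `ℝ^N` with rotationally invariant density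
`f y = g ‖y‖`, and `T = ‖Y‖^N` has density `f_T` on `[0,∞)`, then (assuming the relevant
integrals exist and are finite)
`h(Y) = h(‖Y‖^N) + log₂(π^{N/2} / Γ(N/2 + 1))`. -/
theorem entropy_decomposition_norm_pow
    {N : ℕ} (hN : 1 ≤ N)
    {Ω : Type*} [MeasureSpace Ω] [IsProbabilityMeasure (ℙ : Measure Ω)]
    (Y : Ω → EuclideanSpace ℝ (Fin N)) (hY : Measurable Y)
    (f : EuclideanSpace ℝ (Fin N) → ℝ) (g : ℝ → ℝ) (fT : ℝ → ℝ)
    (hg : Measurable g) (hg0 : ∀ r, 0 ≤ g r)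
    (hfg : ∀ y, f y = g ‖y‖)
    (hf : Measure.map Y ℙ = volume.withDensity fun y => ENNReal.ofReal (f y))
    (hfTm : Measurable fT) (hfT0 : ∀ t, 0 ≤ fT t)
    (hfT : Measure.map (fun ω => ‖Y ω‖ ^ N) ℙ =
      (volume.restrict (Set.Ici (0 : ℝ))).withDensity fun t => ENNReal.ofReal (fT t))
    (hint1 : Integrable (fun y => f y * Real.logb 2 (f y)) (volume : Measure (EuclideanSpace ℝ (Fin N))))
    (hint2 : IntegrableOn (fun t => fT t * Real.logb 2 (fT t)) (Set.Ici (0 : ℝ))) :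
    -∫ y, f y * Real.logb 2 (f y) =
      (-∫ t in Set.Ici (0 : ℝ), fT t * Real.logb 2 (fT t)) +
        Real.logb 2 (Real.pi ^ ((N : ℝ) / 2) / Real.Gamma ((N : ℝ) / 2 + 1)) := by
  have : Nonempty (Fin N) := ⟨⟨0, hN⟩⟩
  have hN0 : N ≠ 0 := by lia
  have hπ : √π ^ N = π ^ ((N : ℝ) / 2) := by
    rw [Real.sqrt_eq_rpow, ← Real.rpow_mul_natCast Real.pi_pos.le]
    congr 1
    ring
  set V : ℝ := π ^ ((N : ℝ) / 2) / Real.Gamma ((N : ℝ) / 2 + 1) with hV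
  have hVpos : 0 < V := div_pos (by positivity) (Real.Gamma_pos_of_pos (by positivity))
  set q : EuclideanSpace ℝ (Fin N) → ℝ := fun y => ‖y‖ ^ N with hq
  have hqm : Measurable q := by fun_prop
  have hmap : volume.map q = ENNReal.ofReal V • volume.restrict (Ici (0 : ℝ)) := by
    have := map_norm_pow_finrank_addHaar (volume : Measure (EuclideanSpace ℝ (Fin N)))
    rwa [EuclideanSpace.volume_ball, finrank_euclideanSpace, Fintype.card_fin, ENNReal.ofReal_one,
      one_pow, one_mul, hπ, ← hV] at this
  set G : ℝ → ℝ := fun t => g (t ^ ((N : ℝ)⁻¹)) with hG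
  have hGm : Measurable G := by fun_prop
  have hG0 (t : ℝ) : 0 ≤ G t := hg0 _
  have hfG : f = G ∘ q := by
    ext y
    simp only [hfg, hG, hq, Function.comp_apply, Real.pow_rpow_inv_natCast (norm_nonneg y) hN0]
  have hdens : (volume.restrict (Ici (0 : ℝ))).withDensity (fun t => ENNReal.ofReal (fT t)) =
      (volume.restrict (Ici (0 : ℝ))).withDensity (fun t => ENNReal.ofReal (V * G t)) := by
    have hcomp : (fun y => ENNReal.ofReal (f y)) = (fun t => ENNReal.ofReal (G t)) ∘ q := by
      rw [hfG]
      rfl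
    rw [← hfT, show (fun ω => ‖Y ω‖ ^ N) = q ∘ Y from rfl, ← Measure.map_map hqm hY, hf, hcomp,
      map_withDensity_comp _ hqm (by fun_prop), hmap, withDensity_smul_measure,
      ← withDensity_smul _ (by fun_prop)]
    congr 1
    ext t
    rw [Pi.smul_apply, smul_eq_mul, ENNReal.ofReal_mul hVpos.le]
  have hae : fT =ᵐ[volume.restrict (Ici (0 : ℝ))] fun t => V * G t := by
    rw [withDensity_eq_iff_of_sigmaFinite (by fun_prop) (by fun_prop)] at hdens
    filter_upwards [hdens] with t ht
    exact (ENNReal.ofReal_eq_ofReal_iff (hfT0 t) (mul_nonneg hVpos.le (hG0 t))).1 ht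
  have hone : ∫⁻ t in Ici (0 : ℝ), ENNReal.ofReal (fT t) = 1 := by
    have hprob := Measure.isProbabilityMeasure_map (μ := (ℙ : Measure Ω)) (hqm.comp hY).aemeasurable
    have := hprob.measure_univ
    rwa [show q ∘ Y = fun ω => ‖Y ω‖ ^ N from rfl, hfT, withDensity_apply _ .univ,
      Measure.restrict_univ] at this
  have hVG_one : ∫ t in Ici (0 : ℝ), V * G t = 1 := by
    rw [← integral_congr_ae hae, integral_eq_lintegral_of_nonneg_ae (.of_forall hfT0)
      hfTm.aestronglyMeasurable, hone, ENNReal.toReal_one]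
  have hGi : Integrable G (volume.restrict (Ici (0 : ℝ))) :=
    (integrable_const_mul_iff hVpos.ne'.isUnit G).1
      (.of_integral_ne_zero (hVG_one ▸ one_ne_zero))
  have hlm : Measurable fun t => G t * Real.logb 2 (G t) := by
    unfold Real.logb
    fun_prop
  have hfint : ∫ y, f y * Real.logb 2 (f y) =
      V * ∫ t in Ici (0 : ℝ), G t * Real.logb 2 (G t) := by
    rw [hfG]
    have := integral_map (μ := volume) hqm.aemeasurable hlm.aestronglyMeasurable
    rw [hmap, integral_smul_measure, ENNReal.toReal_ofReal hVpos.le] at this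
    exact this.symm
  have hGl : Integrable (fun t => G t * Real.logb 2 (G t)) (volume.restrict (Ici (0 : ℝ))) := by
    rw [hfG] at hint1
    have := (integrable_map_measure (μ := volume) hlm.aestronglyMeasurable hqm.aemeasurable).2 hint1
    rwa [hmap, integrable_smul_measure (by simpa using hVpos) ENNReal.ofReal_ne_top] at this
  have hTint : ∫ t in Ici (0 : ℝ), fT t * Real.logb 2 (fT t) =
      ∫ t in Ici (0 : ℝ), V * G t * Real.logb 2 (V * G t) :=
    integral_congr_ae (hae.mono fun t ht => by simp only [ht])
  rw [hfint, hTint, integral_const_mul_mul_logb hVpos.ne' hGi hGl, hVG_one]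
  ring
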